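/- Let A, B, C be affinely independent points in the Euclidean plane, with a = dist B C, b = dist C A, c = dist A B, s = (a+b+c)/2, and let D be the point on segment BC with dist B D = s − b (so AD is the Gergonne cevian from A). For a triangle PQR, let its incenter be the barycentric combination (dist Q R · P + dist R P · Q + dist P Q · R)/(dist Q R + dist R P + dist P Q) and its inradius be 2·area(P,Q,R)/(dist Q R + dist R P + dist P Q). Let I₁, r₁ be the incenter and inradius of triangle ABD and I₂, r₂ those of triangle ADC. Then dist I₁ I₂ = r₁ + r₂, i.e. the incircles of triangles ABD and ADC touch each other. -/

import Mathlib

open EuclideanGeometry Real MeasureTheory RealInnerProductSpace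

noncomputable def area (P Q R : EuclideanSpace ℝ (Fin 2)) : ℝ :=
  (MeasureTheory.volume (convexHull ℝ ({P, Q, R} : Set (EuclideanSpace ℝ (Fin 2))))).toReal

lemma vol_T0 : volume {q : ℝ × ℝ | 0 ≤ q.1 ∧ 0 ≤ q.2 ∧ q.1 + q.2 ≤ 1} = ENNReal.ofReal (1/2) := by
  have hm : MeasurableSet {q : ℝ × ℝ | 0 ≤ q.1 ∧ 0 ≤ q.2 ∧ q.1 + q.2 ≤ 1} := by
    apply IsClosed.measurableSet
    exact (isClosed_le continuous_const continuous_fst).inter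
      ((isClosed_le continuous_const continuous_snd).inter
        (isClosed_le (continuous_fst.add continuous_snd) continuous_const))
  rw [Measure.volume_eq_prod, Measure.prod_apply hm]
  have h1 : ∀ x : ℝ, volume (Prod.mk x ⁻¹' {q : ℝ × ℝ | 0 ≤ q.1 ∧ 0 ≤ q.2 ∧ q.1 + q.2 ≤ 1})
      = (Set.Icc (0:ℝ) 1).indicator (fun x => ENNReal.ofReal (1 - x)) x := by
    intro x
    by_cases hx : x ∈ Set.Icc (0:ℝ) 1
    · rw [Set.indicator_of_mem hx]
      have : Prod.mk x ⁻¹' {q : ℝ × ℝ | 0 ≤ q.1 ∧ 0 ≤ q.2 ∧ q.1 + q.2 ≤ 1} = Set.Icc 0 (1 - x) := by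
        ext y
        simp only [Set.mem_preimage, Set.mem_setOf_eq, Set.mem_Icc]
        constructor
        · rintro ⟨h1, h2, h3⟩; exact ⟨h2, by linarith⟩
        · rintro ⟨h2, h3⟩; exact ⟨hx.1, h2, by linarith⟩
      rw [this, Real.volume_Icc, sub_zero]
    · rw [Set.indicator_of_notMem hx]
      have : Prod.mk x ⁻¹' {q : ℝ × ℝ | 0 ≤ q.1 ∧ 0 ≤ q.2 ∧ q.1 + q.2 ≤ 1} = ∅ := by
        ext y
        simp only [Set.mem_preimage, Set.mem_setOf_eq, Set.mem_empty_iff_false, iff_false]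
        rintro ⟨h1, h2, h3⟩
        exact hx ⟨h1, by linarith⟩
      rw [this, measure_empty]
  simp_rw [h1]
  rw [lintegral_indicator measurableSet_Icc, ← ofReal_integral_eq_lintegral_ofReal]
  · rw [integral_Icc_eq_integral_Ioc, ← intervalIntegral.integral_of_le zero_le_one]
    congr 1
    rw [intervalIntegral.integral_sub (by simp) (by simp)]
    simp
    norm_num
  · exact (continuous_const.sub continuous_id).continuousOn.integrableOn_Icc
  · filter_upwards [ae_restrict_mem measurableSet_Icc] with x hx
    simpa using hx.2

lemma hull_mem (P Q R X : EuclideanSpace ℝ (Fin 2)) :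
    X ∈ convexHull ℝ ({P, Q, R} : Set (EuclideanSpace ℝ (Fin 2))) ↔
      ∃ u v : ℝ, 0 ≤ u ∧ 0 ≤ v ∧ u + v ≤ 1 ∧ X = P + (u • (Q - P) + v • (R - P)) := by
  rw [convexHull_insert (by simp), convexHull_pair, mem_convexJoin]
  constructor
  · rintro ⟨p, rfl, y, ⟨a, b, ha, hb, hab, rfl⟩, ⟨c, d, hc, hd, hcd, rfl⟩⟩
    refine ⟨d * a, d * b, by positivity, by positivity, ?_, ?_⟩
    · rw [← mul_add, hab]; linarith
    · have e1 : c = 1 - d := by linarith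
      have e2 : a = 1 - b := by linarith
      subst e1 e2
      module
  · rintro ⟨u, v, hu, hv, huv, rfl⟩
    refine ⟨P, rfl, ?_⟩
    by_cases h : u + v = 0
    · have hu0 : u = 0 := by linarith
      have hv0 : v = 0 := by linarith
      subst hu0 hv0
      exact ⟨Q, left_mem_segment _ _ _, by simpa using left_mem_segment ℝ P Q⟩
    · refine ⟨(u/(u+v)) • Q + (v/(u+v)) • R, ⟨u/(u+v), v/(u+v), by positivity, by positivity, by field_simp, rfl⟩,
        ⟨1 - (u+v), u+v, by linarith, by positivity, by ring, ?_⟩⟩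
      rw [smul_add, smul_smul, smul_smul, mul_div_cancel₀ _ h, mul_div_cancel₀ _ h]
      module

lemma area_eq (P Q R : EuclideanSpace ℝ (Fin 2)) :
    area P Q R = |(Q 0 - P 0) * (R 1 - P 1) - (Q 1 - P 1) * (R 0 - P 0)| / 2 := by
  let M : Matrix (Fin 2) (Fin 2) ℝ := !![Q 0 - P 0, R 0 - P 0; Q 1 - P 1, R 1 - P 1]
  let f : (Fin 2 → ℝ) →ₗ[ℝ] (Fin 2 → ℝ) := Matrix.toLin' M
  let T : Set (Fin 2 → ℝ) := {q | 0 ≤ q 0 ∧ 0 ≤ q 1 ∧ q 0 + q 1 ≤ 1}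
  have hT : volume T = ENNReal.ofReal (1/2) := by
    rw [← vol_T0, ← (volume_preserving_finTwoArrow ℝ).measure_preimage_equiv]
    rfl
  have hset : (WithLp.toLp 2 : (Fin 2 → ℝ) → EuclideanSpace ℝ (Fin 2)) ⁻¹'
      (convexHull ℝ ({P, Q, R} : Set (EuclideanSpace ℝ (Fin 2)))) =
      (fun x => P.ofLp + x) '' (f '' T) := by
    ext X
    rw [Set.mem_preimage, hull_mem, Set.image_image]
    constructor
    · rintro ⟨u, v, hu, hv, huv, h⟩
      refine ⟨![u, v], ⟨hu, hv, huv⟩, ?_⟩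
      have h' : X = (P + (u • (Q - P) + v • (R - P))).ofLp := by rw [← h]
      rw [h']
      ext i
      fin_cases i <;> simp [f, M, Matrix.mulVec, dotProduct] <;> ring
    · rintro ⟨q, ⟨hu, hv, huv⟩, rfl⟩
      refine ⟨q 0, q 1, hu, hv, huv, ?_⟩
      ext i
      fin_cases i <;> simp [f, M, Matrix.mulVec, dotProduct] <;> ring
  have hv : volume (convexHull ℝ ({P, Q, R} : Set (EuclideanSpace ℝ (Fin 2)))) =
      ENNReal.ofReal |M.det| * ENNReal.ofReal (1/2) := by
    rw [← (EuclideanSpace.volume_preserving_symm_measurableEquiv_toLp (Fin 2)).symm.measure_preimage_equiv]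
    change volume ((WithLp.toLp 2 : (Fin 2 → ℝ) → EuclideanSpace ℝ (Fin 2)) ⁻¹' _) = _
    rw [hset, Set.image_add_left, measure_preimage_add, Measure.addHaar_image_linearMap, hT]
    simp [f]
  rw [area, hv, ENNReal.toReal_mul, ENNReal.toReal_ofReal (abs_nonneg _), ENNReal.toReal_ofReal (by norm_num)]
  simp only [M, Matrix.det_fin_two_of]
  rw [mul_comm (R 0 - P 0)]
  ring

lemma dist_sq2 (P Q : EuclideanSpace ℝ (Fin 2)) :
    dist P Q ^ 2 = (P 0 - Q 0) ^ 2 + (P 1 - Q 1) ^ 2 := by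
  rw [EuclideanSpace.dist_eq, Real.sq_sqrt (by positivity)]
  simp [Real.dist_eq, sq_abs]

/-- The algebraic core. `D` origin, `u` unit vector from `C` to `B`, `v = A - D`. -/
lemma core (x y z d u0 u1 v0 v1 : ℝ) (hxy : 0 < x + y)
    (hp : 0 < x + d + (x + z)) (hq : 0 < y + (y + z) + d)
    (hu : u0 ^ 2 + u1 ^ 2 = 1) (hd : v0 ^ 2 + v1 ^ 2 = d ^ 2)
    (hc : (v0 - x * u0) ^ 2 + (v1 - x * u1) ^ 2 = (x + z) ^ 2)
    (hb : (v0 + y * u0) ^ 2 + (v1 + y * u1) ^ 2 = (y + z) ^ 2) :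
    let p := x + d + (x + z)
    let q := y + (y + z) + d
    ((x / p - y / q) * v0 + d * (x / p + y / q) * u0) ^ 2
      + ((x / p - y / q) * v1 + d * (x / p + y / q) * u1) ^ 2
      = ((x / p + y / q) * (u0 * v1 - u1 * v0)) ^ 2 := by
  intro p q
  have hk : (x + y) * (u0 * v0 + u1 * v1) = z * (y - x) := by
    linear_combination (hb - hc) / 2 + (x ^ 2 - y ^ 2) / 2 * hu
  have hz : (x + y) * (d ^ 2 - z ^ 2) = 4 * x * y * z := by
    linear_combination y * hc + x * hb - (x + y) * hd - (x * y * (x + y)) * hu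
  have key : (x / p - y / q) * d + (u0 * v0 + u1 * v1) * (x / p + y / q) = 0 := by
    have hp' : p ≠ 0 := hp.ne'
    have hq' : q ≠ 0 := hq.ne'
    have : (x + y) * ((x * q - y * p) * d + (u0 * v0 + u1 * v1) * (x * q + y * p)) = 0 := by
      simp only [p, q]
      linear_combination (x - y) * hz + (x * (y + (y + z) + d) + y * (x + d + (x + z))) * hk
    have h2 := (mul_eq_zero.mp this).resolve_left hxy.ne'
    field_simp
    linear_combination h2
  generalize x / p - y / q = α at *
  generalize x / p + y / q = S at *
  have hL : (u0 * v1 - u1 * v0) ^ 2 = d ^ 2 - (u0 * v0 + u1 * v1) ^ 2 := by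
    linear_combination (v0 ^ 2 + v1 ^ 2) * hu + hd
  rw [mul_pow, hL]
  linear_combination (α * d + (u0 * v0 + u1 * v1) * S) * key + α ^ 2 * hd + d ^ 2 * S ^ 2 * hu

theorem gergonne_kissing_incircles
    (A B C : EuclideanSpace ℝ (Fin 2))
    (hABC : AffineIndependent ℝ ![A, B, C])
    (a b c s : ℝ)
    (ha : a = dist B C) (hb : b = dist C A) (hc : c = dist A B)
    (hs : s = (a + b + c) / 2)
    (D : EuclideanSpace ℝ (Fin 2))
    (hD : D ∈ segment ℝ B C) (hDd : dist B D = s - b)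
    (p₁ p₂ r₁ r₂ : ℝ) (I₁ I₂ : EuclideanSpace ℝ (Fin 2))
    (hp₁ : p₁ = dist B D + dist D A + dist A B)
    (hp₂ : p₂ = dist D C + dist C A + dist A D)
    (hI₁ : I₁ = (dist B D / p₁) • A + (dist D A / p₁) • B + (dist A B / p₁) • D)
    (hI₂ : I₂ = (dist D C / p₂) • A + (dist C A / p₂) • D + (dist A D / p₂) • C)
    (hr₁ : r₁ = 2 * area A B D / p₁)
    (hr₂ : r₂ = 2 * area A D C / p₂) :
    dist I₁ I₂ = r₁ + r₂ := by
  have hinj := hABC.injective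
  have hAB : A ≠ B := fun h => by
    have := @hinj 0 1 (by simpa using h); simp at this
  have hBC : B ≠ C := fun h => by
    have := @hinj 1 2 (by simpa using h); simp at this
  have hCA : C ≠ A := fun h => by
    have := @hinj 2 0 (by simpa using h); simp at this
  have ha0 : 0 < a := ha ▸ dist_pos.mpr hBC
  have hb0 : 0 < b := hb ▸ dist_pos.mpr hCA
  have hc0 : 0 < c := hc ▸ dist_pos.mpr hAB
  have hsum : dist B D + dist D C = a := by rw [ha]; exact dist_add_dist_of_mem_segment hD
  obtain ⟨t', t, ht', ht, htt, hDeq⟩ := hD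
  have hD0 : D 0 = t' * B 0 + t * C 0 := by rw [← hDeq]; simp
  have hD1 : D 1 = t' * B 1 + t * C 1 := by rw [← hDeq]; simp
  have et : t' = 1 - t := by linarith
  subst et
  have haq := dist_sq2 B C
  have hxq := dist_sq2 B D
  have hdq := dist_sq2 A D
  have hcq := dist_sq2 A B
  have hbq := dist_sq2 C A
  have hx0 : 0 ≤ dist B D := dist_nonneg
  have hy0 : 0 ≤ dist D C := dist_nonneg
  have hd0 : 0 ≤ dist A D := dist_nonneg
  rw [dist_comm D A] at *
  rw [← ha] at *
  rw [← hb] at *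
  rw [← hc] at *
  generalize dist A D = d at *
  generalize dist D C = y at *
  generalize dist B D = x at *
  have hxt : x = t * a := by
    have : x ^ 2 = (t * a) ^ 2 := by rw [hxq, mul_pow, haq, hD0, hD1]; ring
    exact (pow_left_inj₀ hx0 (by positivity) two_ne_zero).mp this
  have hyt : y = (1 - t) * a := by linarith
  obtain ⟨z, hz⟩ : ∃ z, z = s - a := ⟨_, rfl⟩
  have hcz : c = x + z := by linarith
  have hbz : b = y + z := by linarith
  have hp₁0 : 0 < p₁ := by linarith
  have hp₂0 : 0 < p₂ := by linarith
  obtain ⟨u0, hu0⟩ : ∃ u0, u0 = (B 0 - C 0) / a := ⟨_, rfl⟩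
  obtain ⟨u1, hu1⟩ : ∃ u1, u1 = (B 1 - C 1) / a := ⟨_, rfl⟩
  have hu0' : B 0 - C 0 = a * u0 := by rw [hu0]; field_simp
  have hu1' : B 1 - C 1 = a * u1 := by rw [hu1]; field_simp
  have hB0 : B 0 = D 0 + x * u0 := by rw [hD0, hxt]; linear_combination t * hu0'
  have hB1 : B 1 = D 1 + x * u1 := by rw [hD1, hxt]; linear_combination t * hu1'
  have hC0 : C 0 = D 0 - y * u0 := by rw [hD0, hyt]; linear_combination (t - 1) * hu0'
  have hC1 : C 1 = D 1 - y * u1 := by rw [hD1, hyt]; linear_combination (t - 1) * hu1'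
  clear hD0 hD1
  have hu : u0 ^ 2 + u1 ^ 2 = 1 := by
    have : a ^ 2 * (u0 ^ 2 + u1 ^ 2 - 1) = 0 := by
      rw [hu0', hu1'] at haq; linear_combination -haq
    have := (mul_eq_zero.mp this).resolve_left (by positivity)
    linarith
  have hcore := core x y z d u0 u1 (A 0 - D 0) (A 1 - D 1) (by linarith) (by linarith) (by linarith)
    hu hdq.symm
    (by rw [← hcz, hcq, hB0, hB1]; ring) (by rw [← hbz, hbq, hC0, hC1]; ring)
  simp only at hcore
  have e1 : x + d + (x + z) = p₁ := by linarith
  have e2 : y + (y + z) + d = p₂ := by linarith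
  rw [e1, e2] at hcore
  have har1 : r₁ = x / p₁ * |u0 * (A 1 - D 1) - u1 * (A 0 - D 0)| := by
    rw [hr₁, area_eq, hB0, hB1]
    have : (D 0 + x * u0 - A 0) * (D 1 - A 1) - (D 1 + x * u1 - A 1) * (D 0 - A 0)
      = -x * (u0 * (A 1 - D 1) - u1 * (A 0 - D 0)) := by ring
    rw [this, abs_mul, abs_neg, abs_of_nonneg hx0]
    ring
  have har2 : r₂ = y / p₂ * |u0 * (A 1 - D 1) - u1 * (A 0 - D 0)| := by
    rw [hr₂, area_eq, hC0, hC1]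
    have : (D 0 - A 0) * (D 1 - y * u1 - A 1) - (D 1 - A 1) * (D 0 - y * u0 - A 0)
      = -y * (u0 * (A 1 - D 1) - u1 * (A 0 - D 0)) := by ring
    rw [this, abs_mul, abs_neg, abs_of_nonneg hy0]
    ring
  have hcoef1 : c / p₁ = 1 - x / p₁ - d / p₁ := by
    field_simp; linarith
  have hcoef2 : b / p₂ = 1 - y / p₂ - d / p₂ := by
    field_simp; linarith
  have hI0 : I₁ 0 - I₂ 0 = (x / p₁ - y / p₂) * (A 0 - D 0) + d * (x / p₁ + y / p₂) * u0 := by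
    rw [hI₁, hI₂]; simp only [PiLp.add_apply, PiLp.smul_apply, smul_eq_mul]
    rw [hcoef1, hcoef2, hB0, hC0]; ring
  have hI1 : I₁ 1 - I₂ 1 = (x / p₁ - y / p₂) * (A 1 - D 1) + d * (x / p₁ + y / p₂) * u1 := by
    rw [hI₁, hI₂]; simp only [PiLp.add_apply, PiLp.smul_apply, smul_eq_mul]
    rw [hcoef1, hcoef2, hB1, hC1]; ring
  have hr : r₁ + r₂ = (x / p₁ + y / p₂) * |u0 * (A 1 - D 1) - u1 * (A 0 - D 0)| := by
    rw [har1, har2]; ring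
  have hfin : dist I₁ I₂ ^ 2 = (r₁ + r₂) ^ 2 := by
    rw [dist_sq2, hI0, hI1, hcore, hr, mul_pow, mul_pow, sq_abs]
  exact (pow_left_inj₀ dist_nonneg (by rw [hr]; positivity) two_ne_zero).mp hfin
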